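/- Let n ≥ 2. Then the number of ordered pairs (u, v) of n-cycles on [n] such that the product u∘v has no fixed points equals ((n−1)!)² · ( Σ_{j=0}^{n−1} (−1)^j · n/((n−j)·j!) + (−1)^n / (n−1)! ), as an identity of rational numbers. In particular, this expression in parentheses is the probability that the product of two independent uniformly random n-cycles is fixed-point free. -/

import Mathlib

open Equiv Finset

noncomputable section

/-- The number of cycles of a permutation of `Fin n`, counting fixed points as cycles. -/
def cycleCount {n : ℕ} (σ : Equiv.Perm (Fin n)) : ℕ :=
  σ.cycleType.card + (Finset.univ.filter fun x => σ x = x).card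

/-- A permutation of `Fin n` consisting of a single cycle of length `n`
(equivalently, having exactly one cycle, fixed points counting as cycles). -/
def IsFullCycle {n : ℕ} (σ : Equiv.Perm (Fin n)) : Prop :=
  cycleCount σ = 1

/-- `σ` separates the first `m` elements (`1, …, m`, i.e. indices `0, …, m-1`):
they lie in pairwise distinct cycles of `σ`. -/
def Separates {n : ℕ} (m : ℕ) (σ : Equiv.Perm (Fin n)) : Prop :=
  ∀ i j : Fin n, (i : ℕ) < m → (j : ℕ) < m → i ≠ j → ¬ σ.SameCycle i j

/-- `C_m(N, k)`: the number of permutations of `[N]` with exactly `k` cycles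
that separate the first `m` elements. -/
def sepCount (N m k : ℕ) : ℕ :=
  Nat.card {σ : Equiv.Perm (Fin N) // cycleCount σ = k ∧ Separates m σ}

/-- `C(N, k)`: the signless Stirling number of the first kind, i.e. the number of
permutations of `[N]` with exactly `k` cycles (fixed points counting as cycles). -/
def stirlingCycle (N k : ℕ) : ℕ :=
  Nat.card {σ : Equiv.Perm (Fin N) // cycleCount σ = k}

/-- `v` fixes everything outside `T` and acts on `T` as a single cycle. -/
def FC {α : Type*} (T : Finset α) (v : Equiv.Perm α) : Prop :=
  (∀ x, x ∉ T → v x = x) ∧ ∀ x ∈ T, ∀ y ∈ T, v.SameCycle x y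

theorem FC.ne {α : Type*} [DecidableEq α] {T : Finset α} {v : Equiv.Perm α} (h : FC T v)
    {a : α} (ha : a ∈ T) (hT : 2 ≤ T.card) : v a ≠ a := by
  intro hva
  obtain ⟨y, hy, hya⟩ := Finset.exists_mem_ne (by omega : 1 < T.card) a
  obtain ⟨k, hk⟩ := h.2 a ha y hy
  exact hya (hk.symm.trans (Equiv.Perm.zpow_apply_eq_self_of_apply_eq_self hva k))

theorem FC.maps {α : Type*} {T : Finset α} {v : Equiv.Perm α} (h : FC T v)
    {a : α} (ha : a ∈ T) : v a ∈ T := by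
  by_contra hc
  have := h.1 _ hc
  have h2 := v.injective this
  rw [h2] at hc
  exact hc ha

theorem FC.inv {α : Type*} {T : Finset α} {v : Equiv.Perm α} (h : FC T v) : FC T v⁻¹ := by
  refine ⟨fun x hx => ?_, fun x hx y hy => (h.2 x hx y hy).inv⟩
  rw [Equiv.Perm.inv_eq_iff_eq]
  exact (h.1 x hx).symm

theorem FC.contract {α : Type*} [Fintype α] [DecidableEq α] {T : Finset α} {v : Equiv.Perm α}
    (h : FC T v) {a b : α} (ha : a ∈ T) (hab : v a = b) (hne : b ≠ a) :
    FC (T.erase a) (Equiv.swap a b * v) := by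
  have hb : b ∈ T := hab ▸ h.maps ha
  constructor
  · intro x hx
    by_cases hxa : x = a
    · subst hxa; simp [hab]
    · have hxT : x ∉ T := fun hh => hx (Finset.mem_erase.2 ⟨hxa, hh⟩)
      have hxb : x ≠ b := fun hh => hxT (hh ▸ hb)
      simp [h.1 x hxT, Equiv.swap_apply_of_ne_of_ne hxa hxb]
  · intro x hx y hy
    rw [Finset.mem_erase] at hx hy
    have key : ∀ k : ℕ, (Equiv.swap a b * v).SameCycle x
        (if (v ^ k) x = a then b else (v ^ k) x) := by
      intro k
      induction k with
      | zero =>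
        simp only [pow_zero, Equiv.Perm.one_apply, if_neg hx.1]
        exact Equiv.Perm.SameCycle.refl _ _
      | succ k ih =>
        rw [pow_succ', Equiv.Perm.mul_apply]
        by_cases hz : (v ^ k) x = a
        · rw [if_pos hz] at ih
          rw [hz, hab, if_neg hne]
          exact ih
        · rw [if_neg hz] at ih
          have h2 := ih.apply_right
          rw [Equiv.Perm.mul_apply] at h2
          by_cases hvz : v ((v ^ k) x) = a
          · rw [if_pos hvz]
            rw [hvz, Equiv.swap_apply_left] at h2
            exact h2
          · rw [if_neg hvz]
            have : v ((v ^ k) x) ≠ b := fun hh => hz (v.injective (hh.trans hab.symm))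
            rwa [Equiv.swap_apply_of_ne_of_ne hvz this] at h2
    obtain ⟨k, hk⟩ := (h.2 x hx.2 y hy.2).exists_nat_pow_eq
    have := key k
    rwa [hk, if_neg hy.1] at this

theorem FC.expand {α : Type*} [Fintype α] [DecidableEq α] {T : Finset α} {v : Equiv.Perm α}
    {a b : α} (h : FC (T.erase a) v) (ha : a ∈ T) (hb : b ∈ T) (hne : b ≠ a) :
    FC T (Equiv.swap a b * v) := by
  have hva : v a = a := h.1 a (by simp)
  have hwa : (Equiv.swap a b * v) a = b := by simp [hva]
  have step : ∀ z, z ≠ a → (Equiv.swap a b * v).SameCycle z (v z) := by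
    intro z hz
    have hvz : v z ≠ a := fun hh => hz (v.injective (hh.trans hva.symm))
    by_cases hzb : v z = b
    · have h1 : (Equiv.swap a b * v) z = a := by simp [hzb]
      have h2 : (Equiv.swap a b * v).SameCycle z z := Equiv.Perm.SameCycle.refl _ _
      have h3 := h2.apply_right.apply_right
      rw [h1, hwa] at h3
      rwa [hzb]
    · have h1 : (Equiv.swap a b * v) z = v z := by
        simp [Equiv.swap_apply_of_ne_of_ne hvz hzb]
      have h2 : (Equiv.swap a b * v).SameCycle z z := Equiv.Perm.SameCycle.refl _ _
      have h3 := h2.apply_right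
      rwa [h1] at h3
  have hpow : ∀ x, x ≠ a → ∀ k : ℕ, (v ^ k) x ≠ a ∧ (Equiv.swap a b * v).SameCycle x ((v ^ k) x) := by
    intro x hx k
    induction k with
    | zero => exact ⟨by simpa using hx, by simpa using Equiv.Perm.SameCycle.refl _ _⟩
    | succ k ih =>
      rw [pow_succ', Equiv.Perm.mul_apply]
      exact ⟨fun hh => ih.1 (v.injective (hh.trans hva.symm)), ih.2.trans (step _ ih.1)⟩
  have hba : ∀ x ∈ T, (Equiv.swap a b * v).SameCycle b x := by
    intro x hx
    by_cases hxa : x = a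
    · have h2 : (Equiv.swap a b * v).SameCycle a a := Equiv.Perm.SameCycle.refl _ _
      have h3 := h2.apply_right
      rw [hwa] at h3
      rw [hxa]
      exact h3.symm
    · obtain ⟨k, hk⟩ := (h.2 b (Finset.mem_erase.2 ⟨hne, hb⟩) x
        (Finset.mem_erase.2 ⟨hxa, hx⟩)).exists_nat_pow_eq
      rw [← hk]
      exact (hpow b hne k).2
  constructor
  · intro x hx
    have hxa : x ≠ a := fun hh => hx (hh ▸ ha)
    have hxb : x ≠ b := fun hh => hx (hh ▸ hb)
    have := h.1 x (fun hh => hx (Finset.mem_of_mem_erase hh))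
    simp [this, Equiv.swap_apply_of_ne_of_ne hxa hxb]
  · intro x hx y hy
    exact (hba x hx).symm.trans (hba y hy)

open Classical in
/-- Contracting the arc `a → b`. -/
theorem card_contract {α : Type*} [Fintype α] [DecidableEq α] {T : Finset α}
    {a b : α} (ha : a ∈ T) (hb : b ∈ T) (hne : b ≠ a) (P Q : Equiv.Perm α → Prop)
    (hPQ : ∀ v, P v ↔ Q (Equiv.swap a b * v)) :
    (univ.filter fun v : Equiv.Perm α => FC T v ∧ v a = b ∧ P v).card =
    (univ.filter fun v : Equiv.Perm α => FC (T.erase a) v ∧ Q v).card := by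
  refine Finset.card_bij' (fun v _ => Equiv.swap a b * v) (fun v _ => Equiv.swap a b * v)
    ?_ ?_ ?_ ?_
  · intro v hv
    simp only [Finset.mem_filter, Finset.mem_univ, true_and] at hv ⊢
    exact ⟨hv.1.contract ha hv.2.1 hne, (hPQ v).1 hv.2.2⟩
  · intro v hv
    simp only [Finset.mem_filter, Finset.mem_univ, true_and] at hv ⊢
    refine ⟨hv.1.expand ha hb hne, ?_, ?_⟩
    · have : v a = a := hv.1.1 a (by simp)
      simp [this]
    · rw [hPQ, Equiv.swap_mul_self_mul]
      exact hv.2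
  · intro v _; exact Equiv.swap_mul_self_mul _ _ _
  · intro v _; exact Equiv.swap_mul_self_mul _ _ _

open Classical in
theorem card_FC {α : Type*} [Fintype α] [DecidableEq α] : ∀ (n : ℕ) (T : Finset α), T.card = n + 1 →
    (univ.filter fun v : Equiv.Perm α => FC T v).card = n.factorial := by
  intro n
  induction n with
  | zero =>
    intro T hT
    obtain ⟨a, rfl⟩ := Finset.card_eq_one.1 hT
    rw [Nat.factorial_zero, Finset.card_eq_one]
    refine ⟨1, ?_⟩
    ext v
    simp only [Finset.mem_filter, Finset.mem_univ, true_and, Finset.mem_singleton]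
    constructor
    · intro h
      ext x
      by_cases hx : x = a
      · have := h.maps (a := x) (by simp [hx])
        rw [Finset.mem_singleton] at this
        rw [this, hx]; rfl
      · exact h.1 x (by simpa using hx)
    · rintro rfl
      refine ⟨fun x _ => rfl, ?_⟩
      intro x hx y hy
      simp at hx hy
      rw [hx, hy]
  | succ n ih =>
    intro T hT
    obtain ⟨a, ha⟩ := Finset.card_pos.1 (by omega : 0 < T.card)
    rw [Finset.card_eq_sum_card_fiberwise (f := fun v => v a) (t := T.erase a)]
    · have : ∀ b ∈ T.erase a, ((univ.filter fun v : Equiv.Perm α => FC T v).filter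
          fun v => v a = b).card = n.factorial := by
        intro b hb
        rw [Finset.mem_erase] at hb
        have h1 := card_contract ha hb.2 hb.1 (fun _ => True) (fun _ => True) (fun _ => Iff.rfl)
        simp only [and_true] at h1
        rw [Finset.filter_filter, h1]
        exact ih _ (by rw [Finset.card_erase_of_mem ha, hT]; rfl)
      rw [Finset.sum_congr rfl this, Finset.sum_const, Finset.card_erase_of_mem ha, hT,
        Nat.factorial_succ]
      rfl
    · intro v hv
      simp only [Finset.coe_filter, Finset.mem_univ, true_and, Set.mem_ofPred_eq] at hv
      simp only [Finset.mem_coe, Finset.mem_erase]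
      exact ⟨hv.ne ha (by omega), hv.maps ha⟩

open Classical in
theorem card_FC_agree {α : Type*} [Fintype α] [DecidableEq α] (S : Finset α) : ∀ (n : ℕ) (T : Finset α)
    (w : Equiv.Perm α), T.card = S.card + n + 1 → S ⊆ T → FC T w →
    (univ.filter fun v : Equiv.Perm α => FC T v ∧ ∀ x ∈ S, v x = w x).card = n.factorial := by
  induction S using Finset.induction_on with
  | empty =>
    intro n T w hT _ _
    simpa using card_FC n T (by simpa using hT)
  | insert a S haS ih =>
    intro n T w hT hST hw
    rw [Finset.card_insert_of_notMem haS] at hT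
    have ha : a ∈ T := hST (Finset.mem_insert_self _ _)
    have hne := hw.ne ha (by omega)
    have h1 := card_contract ha (hw.maps ha) hne (fun v => ∀ x ∈ S, v x = w x)
      (fun v => ∀ x ∈ S, v x = (Equiv.swap a (w a) * w) x) (fun v => by simp)
    have h2 : (univ.filter fun v : Equiv.Perm α => FC T v ∧ ∀ x ∈ insert a S, v x = w x) =
        univ.filter fun v : Equiv.Perm α => FC T v ∧ v a = w a ∧ ∀ x ∈ S, v x = w x := by
      ext v
      simp only [Finset.mem_filter, Finset.forall_mem_insert]
    have h3 := ih n (T.erase a) (Equiv.swap a (w a) * w) ?_ ?_ ?_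
    · rw [h2, ← h3]
      convert h1
    · rw [Finset.card_erase_of_mem ha, hT]; omega
    · intro x hx
      exact Finset.mem_erase.2 ⟨fun hh => haS (hh ▸ hx), hST (Finset.mem_insert_of_mem hx)⟩
    · exact hw.contract ha rfl hne

theorem isFullCycle_iff {n : ℕ} (hn : 2 ≤ n) (σ : Equiv.Perm (Fin n)) :
    IsFullCycle σ ↔ FC univ σ := by
  unfold IsFullCycle cycleCount
  have hcard : (univ : Finset (Fin n)).card = n := by simp
  constructor
  · intro h
    refine ⟨fun x hx => absurd (Finset.mem_univ x) hx, fun x _ y _ => ?_⟩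
    rcases Nat.eq_zero_or_pos σ.cycleType.card with h0 | h0
    · have : σ = 1 := by simpa using h0
      subst this
      simp at h
      omega
    · have h1 : σ.cycleType.card = 1 := by omega
      have h2 : (univ.filter fun x => σ x = x).card = 0 := by omega
      rw [Finset.card_eq_zero, Finset.filter_eq_empty_iff] at h2
      rw [Equiv.Perm.card_cycleType_eq_one] at h1
      exact h1.sameCycle (h2 (Finset.mem_univ x)) (h2 (Finset.mem_univ y))
  · intro h
    have hfix : ∀ x, σ x ≠ x := fun x => h.ne (Finset.mem_univ x) (by omega)
    have h2 : (univ.filter fun x => σ x = x).card = 0 := by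
      rw [Finset.card_eq_zero, Finset.filter_eq_empty_iff]
      exact fun x _ => hfix x
    have h1 : σ.cycleType.card = 1 := by
      rw [Equiv.Perm.card_cycleType_eq_one]
      exact ⟨⟨0, by omega⟩, hfix _, fun y _ => h.2 _ (Finset.mem_univ _) _ (Finset.mem_univ _)⟩
    omega

open Classical in
/-- Number of pairs of full cycles whose product fixes `S` pointwise. -/
theorem card_pairs (n : ℕ) (S : Finset (Fin n)) :
    (univ.filter fun p : Equiv.Perm (Fin n) × Equiv.Perm (Fin n) =>
      FC univ p.1 ∧ FC univ p.2 ∧ ∀ x ∈ S, (p.1 * p.2) x = x).card =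
    ∑ u ∈ univ.filter (fun u : Equiv.Perm (Fin n) => FC univ u),
      (univ.filter fun v : Equiv.Perm (Fin n) => FC univ v ∧ ∀ x ∈ S, v x = u⁻¹ x).card := by
  rw [Finset.card_filter, Fintype.sum_prod_type, Finset.sum_filter]
  refine Finset.sum_congr rfl fun u _ => ?_
  by_cases hu : FC univ u
  · simp only [hu, true_and, if_true]
    rw [Finset.card_filter]
    refine Finset.sum_congr rfl fun v _ => ?_
    refine if_congr ?_ rfl rfl
    simp only [Equiv.Perm.mul_apply, Equiv.Perm.eq_inv_iff_eq]
  · simp [hu]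

open Classical in
theorem card_pairs_lt (n : ℕ) (S : Finset (Fin n)) (hS : S.card < n) :
    (univ.filter fun p : Equiv.Perm (Fin n) × Equiv.Perm (Fin n) =>
      FC univ p.1 ∧ FC univ p.2 ∧ ∀ x ∈ S, (p.1 * p.2) x = x).card =
    (n - 1).factorial * (n - S.card - 1).factorial := by
  rw [card_pairs, Finset.sum_congr rfl (g := fun _ => (n - S.card - 1).factorial),
    Finset.sum_const, card_FC (n - 1), smul_eq_mul]
  · simp; omega
  · intro u hu
    simp only [Finset.mem_filter, Finset.mem_univ, true_and] at hu
    convert card_FC_agree S (n - S.card - 1) _ _ (by simp; omega) (Finset.subset_univ _) hu.inv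

open Classical in
theorem card_pairs_univ (n : ℕ) (hn : 2 ≤ n) :
    (univ.filter fun p : Equiv.Perm (Fin n) × Equiv.Perm (Fin n) =>
      FC univ p.1 ∧ FC univ p.2 ∧ ∀ x ∈ (univ : Finset (Fin n)), (p.1 * p.2) x = x).card =
    (n - 1).factorial := by
  rw [card_pairs, Finset.sum_congr rfl (g := fun _ => 1),
    Finset.sum_const, card_FC (n - 1), smul_eq_mul, mul_one]
  · simp; omega
  · intro u hu
    simp only [Finset.mem_filter, Finset.mem_univ, true_and] at hu
    rw [Finset.card_eq_one]
    refine ⟨u⁻¹, ?_⟩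
    ext v
    simp only [Finset.mem_filter, Finset.mem_univ, true_and, Finset.mem_singleton, forall_const]
    constructor
    · intro h
      exact Equiv.ext h.2
    · rintro rfl
      exact ⟨hu.inv, fun _ => rfl⟩

/-- For `n ≥ 2`, the number of ordered pairs `(u, v)` of `n`-cycles on
`[n]` whose product `u ∘ v` has no fixed points equals
`((n-1)!)² ⬝ ( Σ_{j=0}^{n-1} (-1)^j n/((n-j) j!) + (-1)^n/(n-1)! )`,
as an identity of rational numbers. -/
theorem fixed_point_free_probability (n : ℕ) (hn : 2 ≤ n) :
    (Nat.card {p : Equiv.Perm (Fin n) × Equiv.Perm (Fin n) //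
        IsFullCycle p.1 ∧ IsFullCycle p.2 ∧ ∀ x : Fin n, (p.1 * p.2) x ≠ x} : ℚ) =
    (Nat.factorial (n - 1) : ℚ) ^ 2 *
      ((∑ j ∈ Finset.range n,
          (-1 : ℚ) ^ j * n / (((n - j : ℕ) : ℚ) * (Nat.factorial j : ℚ))) +
        (-1 : ℚ) ^ n / (Nat.factorial (n - 1) : ℚ)) := by
  classical
  let N : ℕ → ℚ := fun j => if j < n then ((n - 1).factorial : ℚ) * (n - j - 1).factorial
    else (n - 1).factorial
  have hN : ∀ S : Finset (Fin n), ((univ.filter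
      fun p : Equiv.Perm (Fin n) × Equiv.Perm (Fin n) =>
      FC univ p.1 ∧ FC univ p.2 ∧ ∀ x ∈ S, (p.1 * p.2) x = x).card : ℚ) = N S.card := by
    intro S
    by_cases hS : S.card < n
    · rw [card_pairs_lt n S hS]; simp [N, hS]
    · have : S = univ := by
        rw [← Finset.card_eq_iff_eq_univ]
        have := Finset.card_le_univ S
        simp at this ⊢
        omega
      subst this
      rw [card_pairs_univ n hn]; simp [N]
  have hcount : (Nat.card {p : Equiv.Perm (Fin n) × Equiv.Perm (Fin n) //
        IsFullCycle p.1 ∧ IsFullCycle p.2 ∧ ∀ x : Fin n, (p.1 * p.2) x ≠ x} : ℚ) =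
      ∑ j ∈ Finset.range (n + 1), (n.choose j : ℚ) * ((-1) ^ j * N j) := by
    have h1 : ∑ j ∈ Finset.range (n + 1), (n.choose j : ℚ) * ((-1) ^ j * N j) =
        ∑ S ∈ (univ : Finset (Fin n)).powerset, (-1 : ℚ) ^ S.card * N S.card := by
      rw [Finset.sum_powerset_apply_card (fun j => (-1 : ℚ) ^ j * N j)]
      simp
    rw [h1, Nat.card_eq_fintype_card, Fintype.card_subtype, Finset.card_filter]
    rw [Nat.cast_sum]
    have h2 : ∀ S : Finset (Fin n), (-1 : ℚ) ^ S.card * N S.card =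
        ∑ p : Equiv.Perm (Fin n) × Equiv.Perm (Fin n),
          if FC univ p.1 ∧ FC univ p.2 ∧ ∀ x ∈ S, (p.1 * p.2) x = x then (-1 : ℚ) ^ S.card
          else 0 := by
      intro S
      rw [← hN S, Finset.card_filter]
      rw [Nat.cast_sum, Finset.mul_sum]
      refine Finset.sum_congr rfl fun p _ => ?_
      split_ifs <;> simp
    rw [Finset.sum_congr rfl fun S _ => h2 S, Finset.sum_comm]
    refine Finset.sum_congr rfl fun p _ => ?_
    rw [isFullCycle_iff hn, isFullCycle_iff hn]
    by_cases hu : FC univ p.1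
    swap
    · simp [hu]
    by_cases hv : FC univ p.2
    swap
    · simp [hv]
    simp only [hu, hv, true_and]
    rw [← Finset.sum_filter]
    have h3 : ((univ : Finset (Fin n)).powerset.filter fun S => ∀ x ∈ S, (p.1 * p.2) x = x) =
        (univ.filter fun x => (p.1 * p.2) x = x).powerset := by
      ext S
      simp only [Finset.mem_filter, Finset.mem_powerset, Finset.subset_iff, Finset.mem_univ,
        true_and, implies_true]
    rw [h3]
    have h4 := Finset.sum_powerset_neg_one_pow_card
      (x := univ.filter fun x : Fin n => (p.1 * p.2) x = x)
    have h5 := congrArg (fun z : ℤ => (z : ℚ)) h4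
    simp only [Int.cast_sum, Int.cast_pow, Int.cast_neg, Int.cast_one] at h5
    rw [h5]
    by_cases hf : ∀ x : Fin n, (p.1 * p.2) x ≠ x
    · rw [if_pos hf, if_pos (Finset.filter_eq_empty_iff.2 fun x _ => hf x)]; simp
    · rw [if_neg hf, if_neg fun he => hf fun x => Finset.filter_eq_empty_iff.1 he (mem_univ x)]
      simp
  rw [hcount, Finset.sum_range_succ, mul_add, Finset.mul_sum]
  congr 1
  · refine Finset.sum_congr rfl fun j hj => ?_
    have hj' : j < n := Finset.mem_range.1 hj
    simp only [N, hj', if_true]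
    rw [Nat.cast_choose ℚ hj'.le]
    obtain ⟨m, rfl⟩ : ∃ m, n = j + m + 1 := ⟨n - j - 1, by omega⟩
    have e1 : j + m + 1 - j = m + 1 := by omega
    rw [e1]
    simp only [Nat.add_sub_cancel]
    rw [Nat.factorial_succ (j + m), Nat.factorial_succ m]
    have f1 : ((j + m).factorial : ℚ) ≠ 0 := by positivity
    have f2 : (m.factorial : ℚ) ≠ 0 := by positivity
    have f3 : (j.factorial : ℚ) ≠ 0 := by positivity
    push_cast
    field_simp
  · simp only [N, lt_irrefl, if_false, Nat.choose_self]
    have f1 : ((n - 1).factorial : ℚ) ≠ 0 := by positivity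
    push_cast
    field_simp
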